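/- Let p(x, y) be a nonzero real polynomial of total degree at most 2 in two variables, and let A₁, A₂, A₃, A₄, A₅, A₆ be six distinct points of ℝ² lying on the zero set of p, no three of which are collinear. Suppose the lines A₁A₂ and A₄A₅ meet in exactly one point P₁, the lines A₂A₃ and A₅A₆ meet in exactly one point P₂, and the lines A₃A₄ and A₆A₁ meet in exactly one point P₃. Then P₁, P₂ and P₃ are collinear. -/

import Mathlib

open MvPolynomial in
/-- A bivariate polynomial of total degree at most two is given by its six coefficients. -/
theorem exists_conic_coeffs (p : MvPolynomial (Fin 2) ℝ) (hp : p ≠ 0) (hdeg : p.totalDegree ≤ 2) :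
    ∃ a b c d e f : ℝ, (∀ v : Fin 2 → ℝ, eval v p =
        a * v 0 ^ 2 + b * (v 0 * v 1) + c * v 1 ^ 2 + d * v 0 + e * v 1 + f) ∧
      ¬ (a = 0 ∧ b = 0 ∧ c = 0 ∧ d = 0 ∧ e = 0 ∧ f = 0) := by
  classical
  let m : ℕ × ℕ → (Fin 2 →₀ ℕ) := fun k => Finsupp.single 0 k.1 + Finsupp.single 1 k.2
  have m_zero (k) : m k 0 = k.1 := by simp [m]
  have m_one (k) : m k 1 = k.2 := by simp [m]
  have m_inj : Function.Injective m := fun k l h =>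
    Prod.ext (by rw [← m_zero, h, m_zero]) (by rw [← m_one, h, m_one])
  let S : Finset (ℕ × ℕ) := {(2, 0), (1, 1), (0, 2), (1, 0), (0, 1), (0, 0)}
  have supp_sub : p.support ⊆ S.image m := by
    intro s hs
    have hle : s 0 + s 1 ≤ 2 := by
      have := (le_totalDegree hs).trans hdeg
      rwa [Finsupp.sum_fintype _ _ (fun _ => rfl), Fin.sum_univ_two] at this
    refine Finset.mem_image.2 ⟨(s 0, s 1), ?_, ?_⟩
    · simp only [S, Finset.mem_insert, Finset.mem_singleton, Prod.mk.injEq]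
      omega
    · ext i
      fin_cases i
      · exact m_zero _
      · exact m_one _
  refine ⟨p.coeff (m (2, 0)), p.coeff (m (1, 1)), p.coeff (m (0, 2)), p.coeff (m (1, 0)),
    p.coeff (m (0, 1)), p.coeff (m (0, 0)), fun v => ?_, ?_⟩
  · rw [eval_eq', Finset.sum_subset supp_sub fun s _ hs => by rw [notMem_support_iff.1 hs, zero_mul],
      Finset.sum_image m_inj.injOn]
    simp [S, Fin.prod_univ_two, m_zero, m_one]
    ring
  · rintro ⟨h₁, h₂, h₃, h₄, h₅, h₆⟩
    refine hp (support_eq_empty.1 (Finset.eq_empty_of_forall_notMem fun s hs => ?_))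
    obtain ⟨k, hk, rfl⟩ := Finset.mem_image.1 (supp_sub hs)
    simp only [S, Finset.mem_insert, Finset.mem_singleton] at hk
    rw [mem_support_iff] at hs
    rcases hk with rfl | rfl | rfl | rfl | rfl | rfl <;> exact hs ‹_›

/-- Three points of the plane are collinear if the determinant of their differences vanishes. -/
theorem collinear_of_det_eq_zero {P Q R : Fin 2 → ℝ}
    (h : (Q 0 - P 0) * (R 1 - P 1) - (Q 1 - P 1) * (R 0 - P 0) = 0) :
    Collinear ℝ {P, Q, R} := by
  by_cases hPQ : P = Q
  · subst hPQ
    simpa using collinear_pair ℝ P R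
  have hn : (Q 0 - P 0) ^ 2 + (Q 1 - P 1) ^ 2 ≠ 0 := fun h0 => hPQ <| by
    have h₀ : Q 0 - P 0 = 0 := by nlinarith [sq_nonneg (Q 0 - P 0), sq_nonneg (Q 1 - P 1)]
    have h₁ : Q 1 - P 1 = 0 := by nlinarith [sq_nonneg (Q 0 - P 0), sq_nonneg (Q 1 - P 1)]
    ext i
    fin_cases i <;> simp <;> linarith
  refine (collinear_iff_of_mem (p₀ := P) (by simp)).2 ⟨Q - P, ?_⟩
  simp only [Set.mem_insert_iff, Set.mem_singleton_iff, forall_eq_or_imp, forall_eq]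
  refine ⟨⟨0, by simp⟩, ⟨1, by simp⟩, ((R 0 - P 0) * (Q 0 - P 0) + (R 1 - P 1) * (Q 1 - P 1)) /
    ((Q 0 - P 0) ^ 2 + (Q 1 - P 1) ^ 2), ?_⟩
  ext i
  fin_cases i
  · simp
    field_simp
    linear_combination (-(Q 1 - P 1)) * h
  · simp
    field_simp
    linear_combination (Q 0 - P 0) * h

/-- The values of the nonconstant monomials of degree at most two at five points. -/
def conicMatrix (Q : Fin 5 → Fin 2 → ℝ) : Matrix (Fin 5) (Fin 5) ℝ :=
  Matrix.of fun i => ![Q i 0 ^ 2, Q i 0 * Q i 1, Q i 1 ^ 2, Q i 0, Q i 1]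

/-- Five points on a conic through the origin make the conic matrix singular. -/
theorem det_conicMatrix_eq_zero {Q : Fin 5 → Fin 2 → ℝ} {a b c d e : ℝ}
    (hne : ¬ (a = 0 ∧ b = 0 ∧ c = 0 ∧ d = 0 ∧ e = 0))
    (h : ∀ i, a * Q i 0 ^ 2 + b * (Q i 0 * Q i 1) + c * Q i 1 ^ 2 + d * Q i 0 + e * Q i 1 = 0) :
    (conicMatrix Q).det = 0 := by
  refine Matrix.exists_mulVec_eq_zero_iff.1 ⟨![a, b, c, d, e], fun h0 => hne ?_, ?_⟩
  · exact ⟨congrFun h0 0, congrFun h0 1, congrFun h0 2, congrFun h0 3, congrFun h0 4⟩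
  · ext i
    rw [Matrix.mulVec, dotProduct, Fin.sum_univ_five]
    simp only [conicMatrix, Matrix.of_apply, Pi.zero_apply]
    simp
    linear_combination h i

/-- Homogeneous coordinates of the intersection of the lines `AB` and `CD`. -/
def lineMeet (A B C D : Fin 2 → ℝ) : Fin 3 → ℝ :=
  ![(D 0 - C 0) * (B 0 * A 1 - B 1 * A 0) - (B 0 - A 0) * (D 0 * C 1 - D 1 * C 0),
    (D 1 - C 1) * (B 0 * A 1 - B 1 * A 0) - (B 1 - A 1) * (D 0 * C 1 - D 1 * C 0),
    (B 0 - A 0) * (D 1 - C 1) - (B 1 - A 1) * (D 0 - C 0)]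

/-- If the lines `AB` and `CD` meet only in `P`, then `lineMeet`, computed with respect to any
origin `O`, gives homogeneous coordinates of `P`. -/
theorem lineMeet_of_inter_eq_singleton (O : Fin 2 → ℝ) {A B C D P : Fin 2 → ℝ}
    (hAB : A ≠ B) (hCD : C ≠ D)
    (h : (affineSpan ℝ {A, B} : Set (Fin 2 → ℝ)) ∩ (affineSpan ℝ {C, D} : Set (Fin 2 → ℝ)) = {P}) :
    ∃ w : ℝ, w ≠ 0 ∧
      lineMeet (A - O) (B - O) (C - O) (D - O) = ![w * (P 0 - O 0), w * (P 1 - O 1), w] := by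
  have hP : P ∈ (affineSpan ℝ {A, B} : Set (Fin 2 → ℝ)) ∩ affineSpan ℝ {C, D} := h ▸ rfl
  obtain ⟨t, ht⟩ := mem_affineSpan_pair_iff_exists_lineMap_eq.1 hP.1
  obtain ⟨s, hs⟩ := mem_affineSpan_pair_iff_exists_lineMap_eq.1 hP.2
  have on_line {X Y Z : Fin 2 → ℝ} {r : ℝ} (hr : AffineMap.lineMap X Y r = Z) :
      (Y 0 - X 0) * (Z 1 - X 1) = (Y 1 - X 1) * (Z 0 - X 0) := by
    subst hr
    simp [AffineMap.lineMap_apply]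
    ring
  refine ⟨(B 0 - A 0) * (D 1 - C 1) - (B 1 - A 1) * (D 0 - C 0), fun hW => ?_, ?_⟩
  swap
  · ext i
    fin_cases i <;> simp [lineMeet]
    · linear_combination (B 0 - A 0) * on_line hs - (D 0 - C 0) * on_line ht
    · linear_combination (B 1 - A 1) * on_line hs - (D 1 - C 1) * on_line ht
  have hdir : D 0 - C 0 ≠ 0 ∨ D 1 - C 1 ≠ 0 := by
    by_contra! h0
    apply hCD
    ext i
    fin_cases i <;> simp <;> linarith
  obtain ⟨k, hk⟩ : ∃ k : ℝ, B - A = k • (D - C) := by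
    rcases hdir with hd | hd
    · refine ⟨(B 0 - A 0) / (D 0 - C 0), ?_⟩
      ext i
      fin_cases i <;> simp <;> field_simp
      linear_combination -hW
    · refine ⟨(B 1 - A 1) / (D 1 - C 1), ?_⟩
      ext i
      fin_cases i <;> simp <;> field_simp
      linear_combination hW
  have hmem : P + (B - A) ∈ (affineSpan ℝ {A, B} : Set (Fin 2 → ℝ)) ∩ affineSpan ℝ {C, D} := by
    refine ⟨mem_affineSpan_pair_iff_exists_lineMap_eq.2 ⟨t + 1, ?_⟩,
      mem_affineSpan_pair_iff_exists_lineMap_eq.2 ⟨s + k, ?_⟩⟩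
    · rw [← ht]
      simp only [AffineMap.lineMap_apply, vsub_eq_sub, vadd_eq_add]
      module
    · rw [hk, ← hs]
      simp only [AffineMap.lineMap_apply, vsub_eq_sub, vadd_eq_add]
      module
  rw [h, Set.mem_singleton_iff, add_eq_left, sub_eq_zero] at hmem
  exact hAB hmem.symm

/-- The determinant of the intersections of opposite sides of the hexagon formed by the origin and
five points is, up to sign, the determinant of the conic matrix. -/
theorem det_lineMeet_eq_neg_det_conicMatrix (Q : Fin 5 → Fin 2 → ℝ) :
    (Matrix.of ![lineMeet 0 (Q 0) (Q 2) (Q 3), lineMeet (Q 0) (Q 1) (Q 3) (Q 4),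
      lineMeet (Q 1) (Q 2) (Q 4) 0]).det = -(conicMatrix Q).det := by
  rw [Matrix.det_fin_three]
  simp [conicMatrix, lineMeet, Matrix.det_succ_row_zero, Fin.sum_univ_succ, Fin.succAbove]
  ring

/-- **Pascal's theorem for conics.**
Let `p` be a nonzero real polynomial of total degree at most `2` in two variables and
let `A 0, …, A 5` be six distinct points of the plane on the zero set of `p`, no three
collinear.  If the three pairs of opposite sides of the hexagon meet in single points
`P₁`, `P₂`, `P₃` respectively, then `P₁`, `P₂`, `P₃` are collinear. -/
theorem pascal_theorem_conic
    (p : MvPolynomial (Fin 2) ℝ) (hp : p ≠ 0) (hdeg : p.totalDegree ≤ 2)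
    (A : Fin 6 → (Fin 2 → ℝ)) (hinj : Function.Injective A)
    (hon : ∀ i, MvPolynomial.eval (A i) p = 0)
    (hncol : ∀ i j k : Fin 6, i ≠ j → i ≠ k → j ≠ k → ¬ Collinear ℝ {A i, A j, A k})
    (P₁ P₂ P₃ : Fin 2 → ℝ)
    (hP₁ : (affineSpan ℝ {A 0, A 1} : Set (Fin 2 → ℝ)) ∩
      (affineSpan ℝ {A 3, A 4} : Set (Fin 2 → ℝ)) = {P₁})
    (hP₂ : (affineSpan ℝ {A 1, A 2} : Set (Fin 2 → ℝ)) ∩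
      (affineSpan ℝ {A 4, A 5} : Set (Fin 2 → ℝ)) = {P₂})
    (hP₃ : (affineSpan ℝ {A 2, A 3} : Set (Fin 2 → ℝ)) ∩
      (affineSpan ℝ {A 5, A 0} : Set (Fin 2 → ℝ)) = {P₃}) :
    Collinear ℝ {P₁, P₂, P₃} := by
  obtain ⟨a, b, c, d, e, f, hev, hne⟩ := exists_conic_coeffs p hp hdeg
  simp only [hev] at hon
  let Q : Fin 5 → Fin 2 → ℝ := fun i => A i.succ - A 0
  have hdet : (conicMatrix Q).det = 0 := by
    refine det_conicMatrix_eq_zero (a := a) (b := b) (c := c) (d := 2 * a * A 0 0 + b * A 0 1 + d)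
      (e := b * A 0 0 + 2 * c * A 0 1 + e) ?_ fun i => ?_
    · rintro ⟨rfl, rfl, rfl, hd, he⟩
      have hd : d = 0 := by linarith
      have he : e = 0 := by linarith
      subst hd he
      exact hne ⟨rfl, rfl, rfl, rfl, rfl, by linarith [hon 0]⟩
    · simp only [Q, Pi.sub_apply]
      linear_combination hon i.succ - hon 0
  have hA {i j : Fin 6} (hij : i ≠ j) : A i ≠ A j := hinj.ne hij
  obtain ⟨u, hu, hu'⟩ := lineMeet_of_inter_eq_singleton (A 0) (hA (by decide)) (hA (by decide)) hP₁
  obtain ⟨v, hv, hv'⟩ := lineMeet_of_inter_eq_singleton (A 0) (hA (by decide)) (hA (by decide)) hP₂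
  obtain ⟨w, hw, hw'⟩ := lineMeet_of_inter_eq_singleton (A 0) (hA (by decide)) (hA (by decide)) hP₃
  rw [sub_self] at hu' hw'
  have key := det_lineMeet_eq_neg_det_conicMatrix Q
  rw [hdet, show lineMeet 0 (Q 0) (Q 2) (Q 3) = _ from hu',
    show lineMeet (Q 0) (Q 1) (Q 3) (Q 4) = _ from hv',
    show lineMeet (Q 1) (Q 2) (Q 4) 0 = _ from hw', Matrix.det_fin_three] at key
  simp at key
  refine collinear_of_det_eq_zero (mul_left_cancel₀ (mul_ne_zero (mul_ne_zero hu hv) hw) ?_)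
  linear_combination key
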